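/- Let n ≥ 2 and let p₀, p₁, …, pₙ be points of ℝⁿ whose convex hull Δ has positive n-dimensional Lebesgue measure V(Δ). Then equality (∑_{i=0}^{n} ‖pᵢ‖)ⁿ = n! · √((n+1)^(n−1) · nⁿ) · V(Δ) holds if and only if Δ is a regular n-simplex with symmetry centre the origin, i.e. if and only if ∑_{i=0}^{n} pᵢ = 0 and all pairwise distances ‖pᵢ − pⱼ‖ (i ≠ j) are equal. -/

import Mathlib

open MeasureTheory

theorem volume_cornerSimplex (n : ℕ) (s : ℝ) (hs : 0 ≤ s) :
    volume {x : Fin n → ℝ | (∀ i, 0 ≤ x i) ∧ ∑ i, x i ≤ s} =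
      ENNReal.ofReal (s ^ n / n.factorial) := by
  induction n generalizing s with
  | zero => simp [hs, Measure.volume_pi_eq_dirac (0 : Fin 0 → ℝ)]
  | succ n ih =>
    set S : Set (ℝ × (Fin n → ℝ)) :=
      {z | 0 ≤ z.1 ∧ (∀ i, 0 ≤ z.2 i) ∧ z.1 + ∑ i, z.2 i ≤ s} with hS
    have hSm : MeasurableSet S := by
      apply IsClosed.measurableSet
      simp only [hS, Set.ofPred_and, Set.ofPred_forall]
      refine (isClosed_le (by fun_prop) (by fun_prop)).inter
        ((isClosed_iInter fun i => isClosed_le (by fun_prop) (by fun_prop)).inter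
          (isClosed_le (by fun_prop) (by fun_prop)))
    have hpre : {x : Fin (n + 1) → ℝ | (∀ i, 0 ≤ x i) ∧ ∑ i, x i ≤ s} =
        MeasurableEquiv.piFinSuccAbove (fun _ => ℝ) 0 ⁻¹' S := by
      ext x
      simp [hS, Fin.forall_fin_succ, Fin.sum_univ_succ, MeasurableEquiv.piFinSuccAbove,
        and_assoc]
      exact fun _ => Iff.rfl
    rw [hpre, (volume_preserving_piFinSuccAbove (fun _ => ℝ) 0).measure_preimage
      hSm.nullMeasurableSet, Measure.volume_eq_prod, Measure.prod_apply hSm]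
    have hsec : ∀ a : ℝ, volume (Prod.mk a ⁻¹' S) =
        (Set.Icc 0 s).indicator (fun a => ENNReal.ofReal ((s - a) ^ n / n.factorial)) a := by
      intro a
      by_cases ha : a ∈ Set.Icc 0 s
      · rw [Set.indicator_of_mem ha, ← ih (s - a) (by linarith [ha.2])]
        congr 1
        ext y
        simp [hS, ha.1, le_sub_iff_add_le']
      · rw [Set.indicator_of_notMem ha]
        convert measure_empty (μ := volume)
        ext y
        simp only [hS, Set.mem_preimage, Set.mem_ofPred_eq, Set.mem_empty_iff_false, iff_false]
        rintro ⟨h1, h2, h3⟩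
        exact ha ⟨h1, by linarith [Finset.sum_nonneg fun i (_ : i ∈ Finset.univ) => h2 i]⟩
    simp_rw [hsec]
    rw [lintegral_indicator measurableSet_Icc, ← ofReal_integral_eq_lintegral_ofReal,
      integral_Icc_eq_integral_Ioc, ← intervalIntegral.integral_of_le hs]
    · congr 1
      rw [intervalIntegral.integral_div,
        intervalIntegral.integral_comp_sub_left (fun a => a ^ n) s, sub_self, sub_zero,
        integral_pow, Nat.factorial_succ]
      push_cast
      field_simp
      simp
    · exact (Continuous.continuousOn (by fun_prop)).integrableOn_Icc
    · filter_upwards [ae_restrict_mem measurableSet_Icc] with a ha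
      have := sub_nonneg.2 ha.2
      positivity

theorem convexHull_range_eq_image_cornerSimplex {E : Type*} [AddCommGroup E] [Module ℝ E] {n : ℕ}
    (p : Fin (n + 1) → E) :
    convexHull ℝ (Set.range p) =
      (fun x : Fin n → ℝ => p 0 + ∑ i, x i • (p i.succ - p 0)) ''
        {x | (∀ i, 0 ≤ x i) ∧ ∑ i, x i ≤ 1} := by
  apply Set.Subset.antisymm
  · refine convexHull_min ?_ ?_
    · rintro _ ⟨i, rfl⟩
      refine Fin.cases ?_ (fun j => ?_) i
      · exact ⟨0, by simp, by simp⟩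
      · exact ⟨Pi.single j 1, ⟨fun i => by
          by_cases h : i = j
          · subst h; simp
          · simp [h], by simp⟩, by simp [Pi.single_apply]⟩
    · rintro _ ⟨x, ⟨hx0, hx1⟩, rfl⟩ _ ⟨y, ⟨hy0, hy1⟩, rfl⟩ a b ha hb hab
      refine ⟨a • x + b • y, ⟨fun i => ?_, ?_⟩, ?_⟩
      · have := hx0 i
        have := hy0 i
        simp only [Pi.add_apply, Pi.smul_apply, smul_eq_mul]
        positivity
      · simp only [Pi.add_apply, Pi.smul_apply, smul_eq_mul, Finset.sum_add_distrib,
          ← Finset.mul_sum]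
        nlinarith
      · simp only [Pi.add_apply, Pi.smul_apply, smul_eq_mul, add_smul, mul_smul,
          Finset.sum_add_distrib, ← Finset.smul_sum, smul_add]
        nth_rewrite 1 [← one_smul ℝ (p 0), ← hab]
        rw [add_smul]
        abel
  · rintro _ ⟨x, ⟨hx0, hx1⟩, rfl⟩
    have key := (convex_convexHull ℝ (Set.range p)).sum_mem (t := Finset.univ)
      (w := Fin.cons (1 - ∑ i, x i) x) (z := p)
      (fun i _ => by refine Fin.cases ?_ (fun j => ?_) i <;> simp [hx0, hx1])
      (by simp [Fin.sum_univ_succ]) (fun i _ => subset_convexHull ℝ _ ⟨i, rfl⟩)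
    convert key using 1
    simp only [Fin.sum_univ_succ, Fin.cons_zero, Fin.cons_succ, smul_sub, sub_smul, one_smul,
      Finset.sum_sub_distrib, Finset.sum_smul]
    abel

theorem volume_convexHull_range_simplex {n : ℕ} (p : Fin (n + 1) → EuclideanSpace ℝ (Fin n)) :
    volume (convexHull ℝ (Set.range p)) =
      ENNReal.ofReal
        (|(Matrix.of fun i k : Fin n => p i.succ k - p 0 k).det| / n.factorial) := by
  set A : Matrix (Fin n) (Fin n) ℝ := Matrix.of fun i k => p i.succ k - p 0 k with hA
  set L := Matrix.toLin (EuclideanSpace.basisFun (Fin n) ℝ).toBasis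
    (EuclideanSpace.basisFun (Fin n) ℝ).toBasis A.transpose with hL
  have himg : convexHull ℝ (Set.range p) = (fun y => p 0 + y) '' (L ''
      (WithLp.ofLp ⁻¹' {x : Fin n → ℝ | (∀ i, 0 ≤ x i) ∧ ∑ i, x i ≤ 1})) := by
    rw [convexHull_range_eq_image_cornerSimplex]
    have hf : ∀ x : EuclideanSpace ℝ (Fin n), L x = ∑ i, x i • (p i.succ - p 0) := by
      intro x
      rw [hL, Matrix.toLin_apply]
      ext k
      simp [Matrix.mulVec, dotProduct, hA, mul_comm, Pi.single_apply]
    ext z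
    simp only [Set.mem_image, Set.mem_preimage, exists_exists_and_eq_and, hf]
    exact ⟨fun ⟨x, hx, h⟩ => ⟨WithLp.toLp 2 x, hx, h⟩, fun ⟨x, hx, h⟩ => ⟨x.ofLp, hx, h⟩⟩
  have hm : MeasurableSet {x : Fin n → ℝ | (∀ i, 0 ≤ x i) ∧ ∑ i, x i ≤ 1} := by
    apply IsClosed.measurableSet
    simp only [Set.ofPred_and, Set.ofPred_forall]
    exact (isClosed_iInter fun i => isClosed_le (by fun_prop) (by fun_prop)).inter
      (isClosed_le (by fun_prop) (by fun_prop))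
  rw [himg, Set.image_add_left, measure_preimage_add, Measure.addHaar_image_linearMap,
    (PiLp.volume_preserving_ofLp (Fin n)).measure_preimage hm.nullMeasurableSet,
    volume_cornerSimplex n 1 zero_le_one, hL, LinearMap.det_toLin, Matrix.det_transpose,
    ← ENNReal.ofReal_mul (abs_nonneg _)]
  simp [div_eq_mul_inv]
theorem prod_le_pow_card {ι : Type*} [Fintype ι] (x : ι → ℝ) (hx : ∀ i, 0 ≤ x i) :
    ∏ i, x i ≤ ((∑ i, x i) / Fintype.card ι) ^ Fintype.card ι := by
  rcases isEmpty_or_nonempty ι with h | h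
  · simp
  have h := Real.geom_mean_le_arith_mean Finset.univ (fun _ => 1) x (by simp)
    (by simp [Fintype.card_pos]) fun i _ => hx i
  simp only [Real.rpow_one, Finset.sum_const, Finset.card_univ, nsmul_eq_mul, mul_one, one_mul] at h
  calc ∏ i, x i = ((∏ i, x i) ^ (Fintype.card ι : ℝ)⁻¹) ^ Fintype.card ι :=
        (Real.rpow_inv_natCast_pow (Finset.prod_nonneg fun i _ => hx i) Fintype.card_ne_zero).symm
    _ ≤ _ := by
        gcongr
        exact Real.rpow_nonneg (Finset.prod_nonneg fun i _ => hx i) _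

theorem prod_lt_one_of_sum_eq_card {ι : Type*} [Fintype ι] (x : ι → ℝ) (hx : ∀ i, 0 < x i)
    (hsum : ∑ i, x i = Fintype.card ι) (hne : ∃ i, x i ≠ 1) : ∏ i, x i < 1 := by
  obtain ⟨i, hi⟩ := hne
  calc ∏ i, x i < ∏ i, Real.exp (x i - 1) :=
        Finset.prod_lt_prod (fun i _ => hx i)
          (fun i _ => by linarith [Real.add_one_le_exp (x i - 1)])
          ⟨i, Finset.mem_univ i, by linarith [Real.add_one_lt_exp (sub_ne_zero.2 hi)]⟩
    _ = 1 := by rw [← Real.exp_sum]; simp [hsum]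

theorem eq_smul_one_or_det_lt {ι : Type*} [Fintype ι] [DecidableEq ι] {A : Matrix ι ι ℝ}
    (hA : A.PosSemidef) {t : ℝ} (ht : 0 < t) (htr : A.trace = Fintype.card ι * t) :
    A = t • (1 : Matrix ι ι ℝ) ∨ A.det < t ^ Fintype.card ι := by
  have hH := hA.isHermitian
  by_cases hall : ∀ i, hH.eigenvalues i = t
  · left
    have h := hH.spectral_theorem
    have hd : Matrix.diagonal (RCLike.ofReal ∘ hH.eigenvalues : ι → ℝ) = t • 1 := by
      rw [Matrix.smul_one_eq_diagonal]
      congr 1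
      funext i
      simp [hall i]
    rw [hd, map_smul, map_one] at h
    exact h
  · right
    push Not at hall
    have hdet : A.det = ∏ i, hH.eigenvalues i := by simpa using hH.det_eq_prod_eigenvalues
    have htr' : ∑ i, hH.eigenvalues i = Fintype.card ι * t := by
      rw [← htr]; simpa using hH.trace_eq_sum_eigenvalues.symm
    by_cases hpos : ∀ i, 0 < hH.eigenvalues i
    · have := prod_lt_one_of_sum_eq_card (fun i => hH.eigenvalues i / t)
        (fun i => div_pos (hpos i) ht)
        (by rw [← Finset.sum_div, htr']; field_simp)
        (hall.imp fun i hi h => hi (by rwa [div_eq_one_iff_eq ht.ne'] at h))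
      rw [Finset.prod_div_distrib, Finset.prod_const, Finset.card_univ, div_lt_one (by positivity)]
        at this
      rwa [hdet]
    · push Not at hpos
      obtain ⟨i, hi⟩ := hpos
      have h0 : hH.eigenvalues i = 0 := le_antisymm hi (hA.eigenvalues_nonneg i)
      rw [hdet, Finset.prod_eq_zero (Finset.mem_univ i) h0]
      positivity

theorem prod_mul_sum_inv_le (m : ℕ) (r : Fin (m + 1) → ℝ) (hr : ∀ i, 0 < r i) :
    (∏ i, r i) * ∑ i, (r i)⁻¹ ≤ (m + 1) * ((∑ i, r i) / (m + 1)) ^ m := by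
  induction m with
  | zero => simp [(hr 0).ne']
  | succ m ih =>
    have ih := ih (fun i => r i.succ) fun i => hr _
    rw [Fin.prod_univ_succ, Fin.sum_univ_succ, Fin.sum_univ_succ r]
    set P := ∏ i : Fin (m + 1), r i.succ
    set Q := ∑ i : Fin (m + 1), (r i.succ)⁻¹
    set x := r 0
    have hx : 0 < x := hr 0
    obtain ⟨A, hA⟩ : ∃ A, A = (∑ i : Fin (m + 1), r i.succ) / (m + 1) := ⟨_, rfl⟩
    have hS : ∑ i : Fin (m + 1), r i.succ = (m + 1) * A := by rw [hA]; field_simp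
    have hApos : 0 < A := by
      rw [hA]
      exact div_pos (Finset.sum_pos (fun i _ => hr _) Finset.univ_nonempty) (by positivity)
    have hP : P ≤ A ^ (m + 1) := by
      have h := prod_le_pow_card (fun i : Fin (m + 1) => r i.succ) fun i => (hr _).le
      simpa [hA] using h
    rw [hS] at ih ⊢
    rw [mul_div_cancel_left₀ _ (by positivity)] at ih
    obtain ⟨B, hB⟩ : ∃ B, B = (x + (m + 1) * A) / ((m + 1 : ℕ) + 1) := ⟨_, rfl⟩
    have hBpos : 0 < B := by rw [hB]; positivity
    have hxB : x = (m + 2) * B - (m + 1) * A := by rw [hB]; push_cast; field_simp; ring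
    rw [← hB]
    have hbern : A ^ (m + 1) + (m + 1) * A ^ m * (B - A) ≤ B ^ (m + 1) := by
      have h := one_add_mul_sub_le_pow (a := B / A) (by linarith [div_pos hBpos hApos]) (m + 1)
      rw [div_pow, le_div_iff₀ (by positivity)] at h
      refine le_of_eq_of_le ?_ h
      push_cast
      field_simp
      ring
    calc x * P * (x⁻¹ + Q) = P + x * (P * Q) := by field_simp
      _ ≤ A ^ (m + 1) + x * ((m + 1) * A ^ m) := by gcongr
      _ = (m + 2) * (A ^ (m + 1) + (m + 1) * A ^ m * (B - A)) := by rw [hxB]; ring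
      _ ≤ (m + 2) * B ^ (m + 1) := by gcongr
      _ = _ := by push_cast; ring

theorem succ_pow_pred_lt_pow {n : ℕ} (hn : 2 ≤ n) : (n + 1) ^ (n - 1) < n ^ n := by
  induction n, hn using Nat.le_induction with
  | base => norm_num
  | succ n hn ih =>
    obtain ⟨m, rfl⟩ : ∃ m, n = m + 1 := ⟨n - 1, by omega⟩
    simp only [Nat.add_sub_cancel] at ih ⊢
    refine lt_of_mul_lt_mul_right ?_ (Nat.zero_le ((m + 1) ^ (m + 1)))
    calc (m + 1 + 1 + 1) ^ (m + 1) * (m + 1) ^ (m + 1)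
        = ((m + 3) * (m + 1)) ^ (m + 1) := by rw [mul_pow]
      _ ≤ ((m + 2) * (m + 2)) ^ (m + 1) := by gcongr ?_ ^ _; nlinarith
      _ = (m + 2) ^ (m + 2) * (m + 1 + 1) ^ m := by rw [mul_pow]; ring
      _ < (m + 2) ^ (m + 2) * (m + 1) ^ (m + 1) := by gcongr

theorem det_cons_const_eq {n : ℕ} (c : ℝ) (p : Fin (n + 1) → Fin n → ℝ) :
    (Matrix.of fun i => (Fin.cons c (p i) : Fin (n + 1) → ℝ)).det =
      c * (Matrix.of fun i k : Fin n => p i.succ k - p 0 k).det := by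
  rw [Matrix.det_eq_of_forall_row_eq_smul_add_const (B := Matrix.of (Fin.cons (Fin.cons c (p 0))
    fun i => Fin.cons 0 fun k => p i.succ k - p 0 k)) (Fin.cons 0 fun _ => 1) 0 (by simp)]
  · rw [Matrix.det_succ_column_zero, Fin.sum_univ_succ]
    simp
    left
    congr 1
  · intro i j
    refine Fin.cases ?_ (fun i => ?_) i <;> refine Fin.cases ?_ (fun j => ?_) j <;> simp

theorem abs_det_le_prod_norm {n : ℕ} (q : Fin n → EuclideanSpace ℝ (Fin n)) :
    |(Matrix.of fun i k => q i k).det| ≤ ∏ i, ‖q i‖ := by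
  have : Fact (Module.finrank ℝ (EuclideanSpace ℝ (Fin n)) = n) := ⟨by simp⟩
  have h := (EuclideanSpace.basisFun (Fin n) ℝ).toBasis.orientation.abs_volumeForm_apply_le q
  rw [Orientation.volumeForm_robust' _ (EuclideanSpace.basisFun (Fin n) ℝ), Module.Basis.det_apply]
    at h
  rw [← Matrix.det_transpose]
  convert h using 3
  ext i j
  simp [Module.Basis.toMatrix_apply]

theorem abs_det_sub_le_of_eq_zero {n : ℕ} (p : Fin (n + 1) → EuclideanSpace ℝ (Fin n))
    (k : Fin (n + 1)) (hk : p k = 0) :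
    |(Matrix.of fun i k : Fin n => p i.succ k - p 0 k).det| ≤ ((∑ i, ‖p i‖) / n) ^ n := by
  have h := det_cons_const_eq 1 fun i => (p i).ofLp
  rw [one_mul] at h
  rw [← h, Matrix.det_succ_row _ k, Fin.sum_univ_succ]
  have hsub : (Matrix.of fun i => (Fin.cons 1 (p i).ofLp : Fin (n + 1) → ℝ)).submatrix
      k.succAbove (Fin.succAbove 0) = Matrix.of fun i j => p (k.succAbove i) j := by
    ext i j
    simp
  have h1 := abs_det_le_prod_norm fun i => p (k.succAbove i)
  have h2 := prod_le_pow_card (fun i => ‖p (k.succAbove i)‖) fun _ => norm_nonneg _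
  rw [hsub]
  simpa [hk, abs_mul, Fin.sum_univ_succAbove _ k] using h1.trans h2

/-- The Gram matrix of the vectors `(c, p i)`, normalized by the square roots of `‖p i‖`. -/
noncomputable def liftedGram {n : ℕ} (c : ℝ) (p : Fin (n + 1) → EuclideanSpace ℝ (Fin n)) :
    Matrix (Fin (n + 1)) (Fin (n + 1)) ℝ :=
  Matrix.of fun i j => (c ^ 2 + inner ℝ (p i) (p j)) / (√‖p i‖ * √‖p j‖)

theorem liftedGram_eq {n : ℕ} (c : ℝ) (p : Fin (n + 1) → EuclideanSpace ℝ (Fin n)) :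
    ∃ N : Matrix (Fin (n + 1)) (Fin (n + 1)) ℝ, liftedGram c p = N * N.conjTranspose ∧
      N = Matrix.of fun i j => (√‖p i‖)⁻¹ *
        Matrix.of (fun i => (Fin.cons c (p i).ofLp : Fin (n + 1) → ℝ)) i j := by
  refine ⟨_, ?_, rfl⟩
  ext i j
  simp only [liftedGram, Matrix.mul_apply, Matrix.of_apply, Matrix.conjTranspose_apply,
    Fin.sum_univ_succ, Fin.cons_zero, Fin.cons_succ, PiLp.inner_apply, star_trivial, add_div,
    Finset.sum_div, RCLike.inner_apply, conj_trivial]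
  congr 1
  · field_simp
  · refine Finset.sum_congr rfl fun k _ => ?_
    field_simp

theorem posSemidef_liftedGram {n : ℕ} (c : ℝ) (p : Fin (n + 1) → EuclideanSpace ℝ (Fin n)) :
    (liftedGram c p).PosSemidef := by
  obtain ⟨N, hN, -⟩ := liftedGram_eq c p
  rw [hN]
  exact Matrix.posSemidef_self_mul_conjTranspose _

theorem det_liftedGram {n : ℕ} (c : ℝ) (p : Fin (n + 1) → EuclideanSpace ℝ (Fin n)) :
    (liftedGram c p).det =
      c ^ 2 * (Matrix.of fun i k : Fin n => p i.succ k - p 0 k).det ^ 2 / ∏ i, ‖p i‖ := by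
  have h : ∏ i, ‖p i‖ = (∏ i, √‖p i‖) ^ 2 := by
    rw [← Finset.prod_pow]
    simp
  obtain ⟨N, hN, hN'⟩ := liftedGram_eq c p
  rw [hN, Matrix.det_mul, Matrix.det_conjTranspose, star_trivial, hN', Matrix.det_mul_column,
    det_cons_const_eq, h, Finset.prod_inv_distrib]
  ring

theorem liftedGram_apply_self {n : ℕ} (c : ℝ) (p : Fin (n + 1) → EuclideanSpace ℝ (Fin n))
    (i : Fin (n + 1)) : liftedGram c p i i = c ^ 2 / ‖p i‖ + ‖p i‖ := by
  simp only [liftedGram, Matrix.of_apply, real_inner_self_eq_norm_sq,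
    Real.mul_self_sqrt (norm_nonneg _), add_div, pow_two ‖p i‖, mul_self_div_self]

theorem liftedGram_eq_smul_one_of_equality {n : ℕ} (hn : 0 < n) {c : ℝ}
    (p : Fin (n + 1) → EuclideanSpace ℝ (Fin n)) (hp : ∀ i, 0 < ‖p i‖)
    (hc : c ^ 2 * ∑ i, ‖p i‖⁻¹ = (∑ i, ‖p i‖) / n)
    (h : (∑ i, ‖p i‖) ^ (2 * n) = ((n : ℝ) + 1) ^ (n - 1) * (n : ℝ) ^ n *
      (Matrix.of fun i k : Fin n => p i.succ k - p 0 k).det ^ 2) :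
    liftedGram c p = ((∑ i, ‖p i‖) / n) • (1 : Matrix (Fin (n + 1)) (Fin (n + 1)) ℝ) := by
  set D := (Matrix.of fun i k : Fin n => p i.succ k - p 0 k).det with hD
  have hmac := prod_mul_sum_inv_le n (fun i => ‖p i‖) hp
  have hn' : (0 : ℝ) < n := by exact_mod_cast hn
  have hS : 0 < ∑ i, ‖p i‖ := Finset.sum_pos (fun i _ => hp i) Finset.univ_nonempty
  have hQ : 0 < ∑ i, ‖p i‖⁻¹ := Finset.sum_pos (fun i _ => inv_pos.2 (hp i)) Finset.univ_nonempty
  have hP : 0 < ∏ i, ‖p i‖ := Finset.prod_pos fun i _ => hp i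
  have htr : (liftedGram c p).trace = Fintype.card (Fin (n + 1)) * ((∑ i, ‖p i‖) / n) := by
    simp only [Matrix.trace, Matrix.diag_apply, liftedGram_apply_self, Finset.sum_add_distrib,
      div_eq_mul_inv (c ^ 2), ← Finset.mul_sum, hc, Fintype.card_fin]
    push_cast
    field_simp
    ring
  rcases eq_smul_one_or_det_lt (posSemidef_liftedGram c p) (div_pos hS hn') htr with hA | hA
  · exact hA
  exfalso
  rw [det_liftedGram, ← hD, Fintype.card_fin, div_lt_iff₀ hP] at hA
  generalize (∑ i, ‖p i‖) = S at *
  generalize (∑ i, ‖p i‖⁻¹) = Q at *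
  generalize (∏ i, ‖p i‖) = P at *
  have h1 : D ^ 2 < (S / n) ^ n * (P * Q) := by
    refine lt_of_mul_lt_mul_left ?_ (div_pos hS hn').le
    calc S / n * D ^ 2 = c ^ 2 * D ^ 2 * Q := by rw [← hc]; ring
      _ < (S / n) ^ (n + 1) * P * Q := by gcongr
      _ = _ := by ring
  have h2 : D ^ 2 < (S / n) ^ n * ((n + 1) * (S / (n + 1)) ^ n) := h1.trans_le (by gcongr)
  have h3 : ((n : ℝ) + 1) ^ (n - 1) * (n : ℝ) ^ n * ((S / n) ^ n * ((n + 1) * (S / (n + 1)) ^ n))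
      = S ^ (2 * n) := by
    obtain ⟨m, rfl⟩ : ∃ m, n = m + 1 := ⟨n - 1, by omega⟩
    rw [div_pow, div_pow, two_mul, pow_add S]
    simp only [Nat.add_sub_cancel]
    field_simp
    ring
  rw [← h3] at h
  exact absurd (mul_left_cancel₀ (by positivity) h) h2.ne'

theorem sum_eq_zero_and_norm_sub_eq_of_liftedGram {n : ℕ} (hn : 2 ≤ n) {c : ℝ}
    (p : Fin (n + 1) → EuclideanSpace ℝ (Fin n)) (hp : ∀ i, 0 < ‖p i‖)
    (h : liftedGram c p = ((∑ i, ‖p i‖) / n) • (1 : Matrix (Fin (n + 1)) (Fin (n + 1)) ℝ)) :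
    ∑ i, p i = 0 ∧ ∃ a : ℝ, ∀ i j, i ≠ j → ‖p i - p j‖ = a := by
  have hn' : (2 : ℝ) ≤ n := by exact_mod_cast hn
  obtain ⟨t, ht⟩ : ∃ t, t = (∑ i, ‖p i‖) / n := ⟨_, rfl⟩
  rw [← ht] at h
  have hS : ∑ i, ‖p i‖ = n * t := by rw [ht]; field_simp
  have hdiag : ∀ i, ‖p i‖ ^ 2 + c ^ 2 = t * ‖p i‖ := by
    intro i
    have h1 := congrFun (congrFun h i) i
    have := hp i
    rw [liftedGram_apply_self] at h1
    simp only [Matrix.smul_apply, Matrix.one_apply_eq, smul_eq_mul, mul_one] at h1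
    rw [← h1]
    field_simp
    ring
  have hoff : ∀ i j, i ≠ j → inner ℝ (p i) (p j) = -c ^ 2 := by
    intro i j hij
    have h1 := congrFun (congrFun h i) j
    have := hp i
    have := hp j
    simp only [liftedGram, Matrix.of_apply, Matrix.smul_apply, Matrix.one_apply_ne hij, smul_zero]
      at h1
    rw [div_eq_zero_iff] at h1
    rcases h1 with h1 | h1
    · linarith
    · exact absurd h1 (by positivity)
  have heq : ∀ i j, ‖p i‖ = ‖p j‖ := by
    intro i j
    by_contra hij
    have hne : i ≠ j := fun e => hij (by rw [e])
    have h1 : ‖p i‖ + ‖p j‖ = t := by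
      have : (‖p i‖ - ‖p j‖) * (‖p i‖ + ‖p j‖ - t) = 0 := by linarith [hdiag i, hdiag j]
      rcases mul_eq_zero.1 this with h | h
      · exact absurd (sub_eq_zero.1 h) hij
      · linarith
    have hc : c ^ 2 = ‖p i‖ * ‖p j‖ := by linear_combination hdiag i - ‖p i‖ * h1
    have hlt : ∀ k, 0 < t - ‖p k‖ := fun k => by
      have hcpos : 0 < c ^ 2 := hc ▸ mul_pos (hp i) (hp j)
      exact pos_of_mul_pos_left (a := t - ‖p k‖) (by linarith [hdiag k]) (hp k).le
    obtain ⟨k, -, hk⟩ := Finset.exists_mem_notMem_of_card_lt_card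
      (s := ({i, j} : Finset (Fin (n + 1)))) (t := Finset.univ) (by
        rw [Finset.card_univ, Fintype.card_fin]
        exact Finset.card_le_two.trans_lt (by omega))
    have h2 := Finset.sum_lt_sum_of_subset (Finset.subset_univ {i, j}) (Finset.mem_univ k) hk
      (hlt k) fun l _ _ => (hlt l).le
    rw [Finset.sum_pair hne, Finset.sum_sub_distrib, hS] at h2
    simp only [Finset.sum_const, Finset.card_univ, Fintype.card_fin, nsmul_eq_mul] at h2
    push_cast at h2
    linarith
  have hr : ∀ i, ‖p i‖ = ‖p 0‖ := fun i => heq i 0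
  have hcr : n * c ^ 2 = ‖p 0‖ ^ 2 := by
    have h0 := hdiag 0
    simp only [hr, Finset.sum_const, Finset.card_univ, Fintype.card_fin, nsmul_eq_mul] at hS
    push_cast at hS
    linear_combination n * h0 - ‖p 0‖ * hS
  constructor
  · have : ∀ i, inner ℝ (p i) (∑ j, p j) = 0 := by
      intro i
      rw [inner_sum, Fin.sum_univ_succAbove _ i, real_inner_self_eq_norm_sq, hr i]
      simp only [hoff i _ (Fin.succAbove_ne i _).symm, Finset.sum_const, Finset.card_univ,
        Fintype.card_fin, nsmul_eq_mul]
      linarith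
    rw [← inner_self_eq_zero (𝕜 := ℝ), sum_inner]
    exact Finset.sum_eq_zero fun i _ => this i
  · refine ⟨√(2 * ‖p 0‖ ^ 2 + 2 * c ^ 2), fun i j hij => ?_⟩
    rw [eq_comm, Real.sqrt_eq_iff_mul_self_eq (by positivity) (norm_nonneg _), ← pow_two,
      norm_sub_sq_real, hoff i j hij, hr i, hr j]
    ring

theorem equality_of_regular {n : ℕ} (hn : 0 < n) (p : Fin (n + 1) → EuclideanSpace ℝ (Fin n))
    (hD : (Matrix.of fun i k : Fin n => p i.succ k - p 0 k).det ≠ 0)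
    (h0 : ∑ i, p i = 0) {a : ℝ} (ha : ∀ i j, i ≠ j → ‖p i - p j‖ = a) :
    (∑ i, ‖p i‖) ^ (2 * n) = ((n : ℝ) + 1) ^ (n - 1) * (n : ℝ) ^ n *
      (Matrix.of fun i k : Fin n => p i.succ k - p 0 k).det ^ 2 := by
  have hn' : (0 : ℝ) < n := by exact_mod_cast hn
  have hsum : ∀ i, (n + 1) * ‖p i‖ ^ 2 + ∑ j, ‖p j‖ ^ 2 = n * a ^ 2 := by
    intro i
    have h1 : ∑ j, ‖p i - p j‖ ^ 2 = n * a ^ 2 := by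
      rw [Fin.sum_univ_succAbove _ i]
      simp [ha i _ (Fin.succAbove_ne i _).symm]
    simp only [norm_sub_sq_real, Finset.sum_add_distrib, Finset.sum_sub_distrib, ← Finset.mul_sum,
      ← inner_sum, h0] at h1
    simpa using h1
  have hr0 : ∀ i, ‖p i‖ = ‖p 0‖ := by
    intro i
    have : ‖p i‖ ^ 2 = ‖p 0‖ ^ 2 :=
      mul_left_cancel₀ (by positivity : (n : ℝ) + 1 ≠ 0) (by linarith [hsum i, hsum 0])
    exact (pow_left_inj₀ (norm_nonneg _) (norm_nonneg _) two_ne_zero).1 this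
  have hrpos : 0 < ‖p 0‖ := by
    by_contra hneg
    have hp0 : ‖p 0‖ = 0 := le_antisymm (not_lt.1 hneg) (norm_nonneg _)
    have hle := abs_det_sub_le_of_eq_zero p 0 (norm_eq_zero.1 hp0)
    simp only [hr0, hp0, Finset.sum_const_zero, zero_div, zero_pow hn.ne'] at hle
    exact hD (abs_nonpos_iff.1 hle)
  obtain ⟨r, hrdef⟩ : ∃ r, r = ‖p 0‖ := ⟨_, rfl⟩
  rw [← hrdef] at hrpos
  have hr : ∀ i, ‖p i‖ = r := fun i => (hr0 i).trans hrdef.symm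
  simp only [hr] at hsum
  have hoff : ∀ i j, i ≠ j → inner ℝ (p i) (p j) = -(r ^ 2 / n) := by
    intro i j hij
    have h1 := norm_sub_sq_real (p i) (p j)
    have h2 := hsum 0
    rw [ha i j hij, hr i, hr j] at h1
    simp only [Finset.sum_const, Finset.card_univ, Fintype.card_fin, nsmul_eq_mul] at h2
    push_cast at h2
    field_simp
    linarith [congrArg (fun x => (n : ℝ) * x) h1]
  have hA : liftedGram (r / √n) p = Matrix.diagonal fun _ => (n + 1) * r / n := by
    ext i j
    by_cases hij : i = j
    · subst hij
      rw [liftedGram_apply_self, Matrix.diagonal_apply_eq, hr, div_pow, Real.sq_sqrt hn'.le]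
      field_simp
      ring
    · simp [liftedGram, Matrix.diagonal_apply_ne _ hij, hoff i j hij, div_pow]
  have hdet := det_liftedGram (r / √n) p
  rw [hA, Matrix.det_diagonal, div_pow, Real.sq_sqrt hn'.le] at hdet
  simp only [hr, Finset.prod_const, Finset.sum_const, Finset.card_univ, Fintype.card_fin,
    nsmul_eq_mul] at hdet ⊢
  generalize (Matrix.of fun i k : Fin n => p i.succ k - p 0 k).det = D at *
  have hDsq : D ^ 2 = ((n : ℝ) + 1) ^ (n + 1) * r ^ (2 * n) / n ^ n := by
    rw [div_pow, mul_pow] at hdet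
    field_simp at hdet ⊢
    refine mul_left_cancel₀ (by positivity : (n : ℝ) * r ^ 2 ≠ 0) ?_
    linear_combination -hdet
  rw [hDsq, mul_pow]
  obtain ⟨m, rfl⟩ : ∃ m, n = m + 1 := ⟨n - 1, by omega⟩
  push_cast [Nat.add_sub_cancel]
  field_simp
  ring

theorem simplex_length_equality (n : ℕ) (hn : 2 ≤ n)
    (p : Fin (n + 1) → EuclideanSpace ℝ (Fin n))
    (hV : 0 < volume (convexHull ℝ (Set.range p))) :
    (∑ i, ‖p i‖) ^ n =
      (n.factorial : ℝ) * Real.sqrt (((n : ℝ) + 1) ^ (n - 1) * (n : ℝ) ^ n) *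
        (volume (convexHull ℝ (Set.range p))).toReal ↔
      (∑ i, p i = 0 ∧ ∃ a : ℝ, ∀ i j, i ≠ j → ‖p i - p j‖ = a) := by
  obtain ⟨D, hD⟩ : ∃ D, D = (Matrix.of fun i k : Fin n => p i.succ k - p 0 k).det := ⟨_, rfl⟩
  have hn0 : 0 < n := by omega
  have hn' : (0 : ℝ) < n := by exact_mod_cast hn0
  rw [volume_convexHull_range_simplex, ← hD] at hV ⊢
  have hD0 : D ≠ 0 := by
    rintro rfl
    simp at hV
  have hsq : (∑ i, ‖p i‖) ^ n = (n.factorial : ℝ) *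
        √(((n : ℝ) + 1) ^ (n - 1) * (n : ℝ) ^ n) * (ENNReal.ofReal (|D| / n.factorial)).toReal ↔
      (∑ i, ‖p i‖) ^ (2 * n) = ((n : ℝ) + 1) ^ (n - 1) * (n : ℝ) ^ n * D ^ 2 := by
    rw [ENNReal.toReal_ofReal (by positivity), ← pow_left_inj₀ (by positivity) (by positivity)
      two_ne_zero, ← pow_mul, mul_comm n 2]
    have hf : (n.factorial : ℝ) ≠ 0 := by positivity
    rw [show (n.factorial : ℝ) * √(((n : ℝ) + 1) ^ (n - 1) * (n : ℝ) ^ n) * (|D| / n.factorial) =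
      √(((n : ℝ) + 1) ^ (n - 1) * (n : ℝ) ^ n) * |D| by field_simp, mul_pow,
      Real.sq_sqrt (by positivity), sq_abs]
  rw [hsq, hD]
  constructor
  · intro h
    have hp : ∀ i, 0 < ‖p i‖ := by
      intro k
      by_contra hk
      have hk : p k = 0 := by simpa using hk
      have hle := abs_det_sub_le_of_eq_zero p k hk
      rw [← hD] at h hle
      have hlt : ((n : ℝ) + 1) ^ (n - 1) < (n : ℝ) ^ n := by exact_mod_cast succ_pow_pred_lt_pow hn
      have hle2 : D ^ 2 * (n : ℝ) ^ (2 * n) ≤ (∑ i, ‖p i‖) ^ (2 * n) := by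
        rw [← le_div_iff₀ (by positivity), ← div_pow, mul_comm 2 n, pow_mul, ← sq_abs]
        gcongr
      have : ((n : ℝ) + 1) ^ (n - 1) * (n : ℝ) ^ n * D ^ 2 < (n : ℝ) ^ n * (n : ℝ) ^ n * D ^ 2 := by
        have : 0 < D ^ 2 := by positivity
        gcongr
      rw [two_mul, pow_add] at hle2
      rw [two_mul] at h
      linarith
    have hQ : 0 < ∑ i, ‖p i‖⁻¹ :=
      Finset.sum_pos (fun i _ => inv_pos.2 (hp i)) Finset.univ_nonempty
    refine sum_eq_zero_and_norm_sub_eq_of_liftedGram hn p hp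
      (liftedGram_eq_smul_one_of_equality hn0
        (c := √((∑ i, ‖p i‖) / n / ∑ i, ‖p i‖⁻¹)) p hp ?_ h)
    rw [Real.sq_sqrt (by positivity), div_mul_cancel₀ _ hQ.ne']
  · rintro ⟨h0, a, ha⟩
    exact equality_of_regular hn0 p (hD ▸ hD0) h0 ha
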